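/- Let (D, M, μ) be a measure space, X = L^p(D,μ) with p ∈ (1,∞), X* = L^{p*}(D,μ) its dual. Let q and m be finite nonnegative Borel measures on [0,T], f* : [0,T] → X* bounded measurable with f*_t ≥ 0, Θ : [0,T]² → L(X) strongly continuous with each Θ(t,s) positivity-preserving, and ρ : [0,T] → X Bochner measurable nonnegative with ∫ ‖ρ_s‖ dm(s) < ∞. Then ∫₀^T ⟨f*_t, ∫₀^t Θ(t,s)ρ_s dm(s)⟩ dq(t) = ∫₀^T ⟨∫_s^T Θ(t,s)* f*_t dq(t), ρ_s⟩ dm(s). -/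

import Mathlib

open Set MeasureTheory ENNReal

/-- The duality map `sign w * |w| ^ (r - 1)`. -/
noncomputable def dualJ (r w : ℝ) : ℝ := (max w 0) ^ (r - 1) - (max (-w) 0) ^ (r - 1)

lemma dualJ_continuous {r : ℝ} (hr : 1 < r) : Continuous (dualJ r) := by
  unfold dualJ
  fun_prop (disch := grind)

lemma dualJ_of_nonneg {r w : ℝ} (hr : 1 < r) (hw : 0 ≤ w) : dualJ r w = w ^ (r - 1) := by
  unfold dualJ
  rw [max_eq_left hw, max_eq_right (by linarith), Real.zero_rpow (by linarith), sub_zero]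

lemma dualJ_neg {r w : ℝ} : dualJ r (-w) = - dualJ r w := by
  unfold dualJ
  rw [neg_neg]; ring

lemma dualJ_abs {r : ℝ} (hr : 1 < r) (w : ℝ) : |dualJ r w| = |w| ^ (r - 1) := by
  rcases le_total 0 w with h | h
  · rw [dualJ_of_nonneg hr h, abs_of_nonneg h, abs_of_nonneg (Real.rpow_nonneg h _)]
  · have h' : 0 ≤ -w := by linarith
    rw [← abs_neg, ← dualJ_neg, dualJ_of_nonneg hr h', abs_of_nonpos h,
      abs_of_nonneg (Real.rpow_nonneg h' _)]

lemma dualJ_mul_self {r : ℝ} (hr : 1 < r) (w : ℝ) : w * dualJ r w = |w| ^ r := by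
  have key : ∀ w : ℝ, 0 ≤ w → w * dualJ r w = |w| ^ r := by
    intro w h
    rw [dualJ_of_nonneg hr h, abs_of_nonneg h]
    rcases h.eq_or_lt with rfl | h
    · rw [zero_mul, Real.zero_rpow (by linarith)]
    · nth_rewrite 1 [← Real.rpow_one w]
      rw [← Real.rpow_add h]; congr 1; ring
  rcases le_total 0 w with h | h
  · exact key w h
  · have := key (-w) (by linarith)
    rw [dualJ_neg, abs_neg] at this
    linarith

lemma dualJ_smul {r : ℝ} (hr : 1 < r) {c : ℝ} (hc : 0 ≤ c) (w : ℝ) :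
    dualJ r (c * w) = c ^ (r - 1) * dualJ r w := by
  have key : ∀ w : ℝ, 0 ≤ w → dualJ r (c * w) = c ^ (r - 1) * dualJ r w := by
    intro w h
    rw [dualJ_of_nonneg hr h, dualJ_of_nonneg hr (by positivity), Real.mul_rpow hc h]
  rcases le_total 0 w with h | h
  · exact key w h
  · have := key (-w) (by linarith)
    rw [mul_neg, dualJ_neg, dualJ_neg] at this
    linarith

/-- Bregman distance of `|·| ^ r`. -/
noncomputable def breg (r v w : ℝ) : ℝ := |v| ^ r - |w| ^ r - r * (dualJ r w * (v - w))

lemma breg_smul {r : ℝ} (hr : 1 < r) {c : ℝ} (hc : 0 ≤ c) (v w : ℝ) :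
    breg r (c * v) (c * w) = c ^ r * breg r v w := by
  unfold breg
  have h : c ^ r = c ^ (r - 1) * c := by
    have := dualJ_mul_self hr c
    rw [dualJ_of_nonneg hr hc, abs_of_nonneg hc] at this
    linarith
  rw [dualJ_smul hr hc, abs_mul, abs_mul, Real.mul_rpow (abs_nonneg _) (abs_nonneg _),
    Real.mul_rpow (abs_nonneg _) (abs_nonneg _), abs_of_nonneg hc, h]
  ring

lemma breg_neg {r v w : ℝ} : breg r (-v) (-w) = breg r v w := by
  unfold breg
  rw [dualJ_neg, abs_neg, abs_neg]; ring

lemma breg_one_pos {r v : ℝ} (hr : 1 < r) (hv : v ≠ 1) : 0 < breg r v 1 := by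
  have h1 : dualJ r 1 = 1 := by rw [dualJ_of_nonneg hr zero_le_one, Real.one_rpow]
  unfold breg
  rw [h1, abs_one, Real.one_rpow]
  rcases le_or_gt 0 v with h | h
  · have := one_add_mul_self_lt_rpow_one_add (s := v - 1) (by linarith) (sub_ne_zero.2 hv) hr
    rw [abs_of_nonneg h]
    rw [show 1 + (v - 1) = v by ring] at this
    linarith
  · have := one_add_mul_self_le_rpow_one_add (s := -v - 1) (by linarith) hr.le
    rw [abs_of_neg h]
    rw [show 1 + (-v - 1) = -v by ring] at this
    nlinarith

lemma breg_pos {r v w : ℝ} (hr : 1 < r) (hv : v ≠ w) : 0 < breg r v w := by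
  have key : ∀ v w : ℝ, 0 < w → v ≠ w → 0 < breg r v w := by
    intro v w hw hv
    have := breg_smul hr hw.le (v / w) 1
    rw [mul_one, mul_div_cancel₀ _ hw.ne'] at this
    rw [this]
    exact mul_pos (Real.rpow_pos_of_pos hw _) (breg_one_pos hr (by rwa [Ne, div_eq_one_iff_eq hw.ne']))
  rcases lt_trichotomy w 0 with h | rfl | h
  · rw [← breg_neg]
    exact key _ _ (by linarith) (by simpa using hv)
  · unfold breg
    rw [dualJ_of_nonneg hr le_rfl, abs_zero, Real.zero_rpow (by linarith), Real.zero_rpow (by linarith)]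
    have := Real.rpow_pos_of_pos (abs_pos.2 hv) r
    linarith
  · exact key _ _ h hv

lemma breg_self {r v : ℝ} : breg r v v = 0 := by simp [breg]

lemma breg_nonneg {r v w : ℝ} (hr : 1 < r) : 0 ≤ breg r v w := by
  by_cases h : v = w
  · subst h; rw [breg_self]
  · exact (breg_pos hr h).le

lemma breg_control {r : ℝ} (hr : 1 < r) {η : ℝ} (hη : 0 < η) :
    ∃ C : ℝ, 0 ≤ C ∧ ∀ v w : ℝ, |v - w| ^ r ≤ C * breg r v w + η * (|v| ^ r + |w| ^ r) := by
  have hr0 : 0 ≤ r := by linarith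
  have cF : Continuous fun z : ℝ × ℝ => |z.1 - z.2| ^ r := by
    fun_prop (disch := grind)
  have cB : Continuous fun z : ℝ × ℝ => breg r z.1 z.2 := by
    unfold breg
    have := dualJ_continuous hr
    fun_prop (disch := grind)
  let S : Set (ℝ × ℝ) := Metric.sphere 0 1 ∩ {z | η ≤ |z.1 - z.2| ^ r}
  have hS : IsCompact S :=
    (isCompact_sphere _ _).inter_right (isClosed_le continuous_const cF)
  have hpos : ∀ z ∈ S, 0 < breg r z.1 z.2 := by
    rintro z ⟨_, hz⟩
    apply breg_pos hr
    intro h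
    simp only [Set.mem_ofPred_eq, h, sub_self, abs_zero] at hz
    rw [Real.zero_rpow (by linarith)] at hz
    linarith
  have hex : ∃ C : ℝ, 0 ≤ C ∧ ∀ z ∈ S, |z.1 - z.2| ^ r ≤ C * breg r z.1 z.2 := by
    have hc : ContinuousOn (fun z : ℝ × ℝ => |z.1 - z.2| ^ r / breg r z.1 z.2) S :=
      cF.continuousOn.div cB.continuousOn (fun z hz => (hpos z hz).ne')
    obtain ⟨C, hC⟩ := (hS.image_of_continuousOn hc).bddAbove
    refine ⟨max C 0, le_max_right _ _, fun z hz => ?_⟩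
    rw [← div_le_iff₀ (hpos z hz)]
    exact (hC ⟨z, hz, rfl⟩).trans (le_max_left _ _)
  obtain ⟨C, hC0, hC⟩ := hex
  refine ⟨C, hC0, fun v w => ?_⟩
  set c : ℝ := ‖((v, w) : ℝ × ℝ)‖ with hc
  have hcdef : c = max |v| |w| := by rw [hc, Prod.norm_def]; rfl
  by_cases hc0 : c = 0
  · have : ((v, w) : ℝ × ℝ) = 0 := norm_eq_zero.1 hc0
    obtain ⟨rfl, rfl⟩ := Prod.mk_eq_zero.1 this
    rw [breg_self, sub_self, abs_zero, Real.zero_rpow (by linarith)]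
    simp
  have hcp : 0 < c := lt_of_le_of_ne (norm_nonneg _) (Ne.symm hc0)
  have e1 : v = c * (v / c) := by field_simp
  have e2 : w = c * (w / c) := by field_simp
  have hcr : 0 < c ^ r := Real.rpow_pos_of_pos hcp _
  have hF : |v - w| ^ r = c ^ r * |v / c - w / c| ^ r := by
    rw [← Real.mul_rpow hcp.le (abs_nonneg _)]
    congr 1
    rw [← abs_of_pos hcp, ← abs_mul, abs_of_pos hcp]
    congr 1; field_simp
  have hB : breg r v w = c ^ r * breg r (v / c) (w / c) := by
    rw [← breg_smul hr hcp.le, ← e1, ← e2]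
  have hsum : c ^ r ≤ |v| ^ r + |w| ^ r := by
    have a := Real.rpow_nonneg (abs_nonneg v) r
    have b := Real.rpow_nonneg (abs_nonneg w) r
    rcases max_choice |v| |w| with h | h <;> rw [hcdef, h] <;> linarith
  have hB0 := breg_nonneg (v := v) (w := w) hr
  by_cases hz : η ≤ |v / c - w / c| ^ r
  · have := hC (v / c, w / c) ⟨by
      rw [mem_sphere_zero_iff_norm, Prod.norm_def]
      simp only [Real.norm_eq_abs, abs_div, abs_of_pos hcp]
      rw [max_div_div_right hcp.le, ← hcdef, div_self hc0], hz⟩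
    simp only at this
    have h2 := mul_le_mul_of_nonneg_left this hcr.le
    rw [hF]
    have h3 : 0 ≤ η * (|v| ^ r + |w| ^ r) := by positivity
    rw [hB]
    linarith
  · push Not at hz
    have h1 : |v - w| ^ r ≤ c ^ r * η := by
      rw [hF]; exact mul_le_mul_of_nonneg_left hz.le hcr.le
    have h2 : η * c ^ r ≤ η * (|v| ^ r + |w| ^ r) := mul_le_mul_of_nonneg_left hsum hη.le
    have h3 := mul_nonneg hC0 hB0
    linarith

section LpPart

set_option linter.unusedSectionVars false

variable {D : Type*} [MeasurableSpace D] {μ : Measure D} {p p' : ℝ≥0∞}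

lemma Lp_norm_rpow {p : ℝ≥0∞} (h0 : p ≠ 0) (ht : p ≠ ⊤) (w : Lp ℝ p μ) :
    ‖w‖ ^ p.toReal = ∫ x, |w x| ^ p.toReal ∂μ := by
  have hpos : 0 < p.toReal := ENNReal.toReal_pos h0 ht
  have hI : 0 ≤ ∫ x, ‖w x‖ ^ p.toReal ∂μ := integral_nonneg fun x => by positivity
  rw [Lp.norm_def, (Lp.memLp w).eLpNorm_eq_integral_rpow_norm h0 ht,
    ENNReal.toReal_ofReal (by positivity), ← Real.rpow_mul hI, inv_mul_cancel₀ hpos.ne',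
    Real.rpow_one]
  rfl

variable [Fact (1 ≤ p)] [Fact (1 ≤ p')] [p'.HolderConjugate p]

/-- The duality pairing as a continuous bilinear map. -/
noncomputable def pairL (μ : Measure D) (p p' : ℝ≥0∞) [Fact (1 ≤ p)] [Fact (1 ≤ p')]
    [p'.HolderConjugate p] : Lp ℝ p' μ →L[ℝ] Lp ℝ p μ →L[ℝ] ℝ :=
  (ContinuousLinearMap.mul ℝ ℝ).lpPairing μ p' p

lemma pairL_eq (w : Lp ℝ p' μ) (h : Lp ℝ p μ) : pairL μ p p' w h = ∫ x, w x * h x ∂μ := by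
  simp [pairL, ContinuousLinearMap.lpPairing_eq_integral]

lemma pairL_integrable (w : Lp ℝ p' μ) (h : Lp ℝ p μ) : Integrable (fun x => w x * h x) μ := by
  have := ContinuousLinearMap.memLp_of_bilin (ContinuousLinearMap.mul ℝ ℝ) (r := 1) (Lp.memLp w) (Lp.memLp h)
  simpa [memLp_one_iff_integrable] using this

lemma toReal_conj (hp : p ≠ ⊤) (hp' : p' ≠ ⊤) : p'.toReal.HolderConjugate p.toReal :=
  ENNReal.HolderConjugate.toReal_of_ne_top hp' hp

lemma memLp_dualJ (hp : p ≠ ⊤) (hp' : p' ≠ ⊤) (w : Lp ℝ p' μ) :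
    MemLp (fun x => dualJ p'.toReal (w x)) p μ := by
  have hc := toReal_conj (p := p) (p' := p') hp hp'
  have hr := hc.lt
  have h1 := (Lp.memLp w).norm_rpow_div (ENNReal.ofReal (p'.toReal - 1))
  rw [ENNReal.toReal_ofReal (by linarith)] at h1
  have e : p' / ENNReal.ofReal (p'.toReal - 1) = p := by
    have := hc.conjugate_eq
    rw [← ENNReal.ofReal_toReal hp', ← ENNReal.ofReal_toReal hp,
      ENNReal.toReal_ofReal (by positivity), ← ENNReal.ofReal_div_of_pos (by linarith), ← this]
  rw [e] at h1
  refine h1.of_le ((dualJ_continuous hr).comp_aestronglyMeasurable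
    (Lp.aestronglyMeasurable w)) (Filter.Eventually.of_forall fun x => ?_)
  rw [Real.norm_eq_abs, dualJ_abs hr, Real.norm_eq_abs, Real.norm_eq_abs]
  exact le_abs_self _

/-- The duality map on the dual space. -/
noncomputable def LpJ (hp : p ≠ ⊤) (hp' : p' ≠ ⊤) (w : Lp ℝ p' μ) : Lp ℝ p μ :=
  (memLp_dualJ hp hp' w).toLp _

lemma LpJ_coe (hp : p ≠ ⊤) (hp' : p' ≠ ⊤) (w : Lp ℝ p' μ) :
    LpJ (p := p) hp hp' w =ᵐ[μ] fun x => dualJ p'.toReal (w x) :=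
  MemLp.coeFn_toLp _

lemma pairL_LpJ (hp : p ≠ ⊤) (hp' : p' ≠ ⊤) (w : Lp ℝ p' μ) :
    pairL μ p p' w (LpJ hp hp' w) = ‖w‖ ^ p'.toReal := by
  have hr := (toReal_conj (p := p) (p' := p') hp hp').lt
  rw [pairL_eq, Lp_norm_rpow (by rintro rfl; simp at hr; linarith) hp']
  apply integral_congr_ae
  filter_upwards [LpJ_coe (p := p) hp hp' w] with x hx
  rw [hx, dualJ_mul_self hr]

lemma norm_LpJ (hp : p ≠ ⊤) (hp' : p' ≠ ⊤) (w : Lp ℝ p' μ) :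
    ‖LpJ (p := p) hp hp' w‖ = ‖w‖ ^ (p'.toReal - 1) := by
  have hc := toReal_conj (p := p) (p' := p') hp hp'
  have hr := hc.lt
  have hs := hc.symm.lt
  have h1 : ‖LpJ (p := p) hp hp' w‖ ^ p.toReal = ‖w‖ ^ p'.toReal := by
    rw [Lp_norm_rpow (by rintro rfl; simp at hs; linarith) hp,
      Lp_norm_rpow (by rintro rfl; simp at hr; linarith) hp']
    apply integral_congr_ae
    filter_upwards [LpJ_coe (p := p) hp hp' w] with x hx
    rw [hx, dualJ_abs hr, ← Real.rpow_mul (abs_nonneg _), hc.sub_one_mul_conj]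
  have h2 : ‖w‖ ^ p'.toReal = (‖w‖ ^ (p'.toReal - 1)) ^ p.toReal := by
    rw [← Real.rpow_mul (norm_nonneg _), hc.sub_one_mul_conj]
  rw [h2] at h1
  exact (Real.rpow_left_inj (norm_nonneg _) (by positivity) (by linarith)).1 h1

lemma norm_le_of_pairL (hp : p ≠ ⊤) (hp' : p' ≠ ⊤) (w : Lp ℝ p' μ) {C : ℝ} (hC : 0 ≤ C)
    (h : ∀ y : Lp ℝ p μ, pairL μ p p' w y ≤ C * ‖y‖) : ‖w‖ ≤ C := by
  rcases (norm_nonneg w).eq_or_lt with h0 | h0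
  · rwa [← h0]
  have h1 := h (LpJ hp hp' w)
  rw [pairL_LpJ, norm_LpJ] at h1
  have h2 : ‖w‖ ^ p'.toReal = ‖w‖ * ‖w‖ ^ (p'.toReal - 1) := by
    rw [← Real.rpow_one_add' h0.le (by
      have := (toReal_conj (p := p) (p' := p') hp hp').lt
      linarith)]
    congr 1; ring
  rw [h2] at h1
  exact le_of_mul_le_mul_right h1 (Real.rpow_pos_of_pos h0 _)

lemma pairL_le (w : Lp ℝ p' μ) : ∀ y : Lp ℝ p μ, pairL μ p p' w y ≤ ‖w‖ * ‖y‖ := by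
  intro y
  have h := ContinuousLinearMap.le_opNorm₂ (pairL μ p p') w y
  have h1 : ‖pairL μ p p'‖ ≤ 1 := by
    refine ContinuousLinearMap.opNorm_le_bound₂ _ zero_le_one fun w y => ?_
    rw [pairL_eq, one_mul]
    have h2 := ContinuousLinearMap.norm_holder_apply_apply_le (r := 1)
      (ContinuousLinearMap.mul ℝ ℝ) w y
    have h3 : ‖∫ x, w x * y x ∂μ‖ ≤ ‖(ContinuousLinearMap.mul ℝ ℝ).holder 1 w y‖ := by
      rw [L1.norm_eq_integral_norm]
      refine (norm_integral_le_integral_norm _).trans (le_of_eq ?_)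
      apply integral_congr_ae
      filter_upwards [ContinuousLinearMap.coeFn_holder (r := 1) (ContinuousLinearMap.mul ℝ ℝ) w y]
        with x hx
      rw [hx]; rfl
    have h4 : ‖ContinuousLinearMap.mul ℝ ℝ‖ ≤ 1 := ContinuousLinearMap.opNorm_mul_le _ _
    have h5 : ‖ContinuousLinearMap.mul ℝ ℝ‖ * ‖w‖ * ‖y‖ ≤ 1 * ‖w‖ * ‖y‖ := by gcongr
    linarith
  have h5 : ‖pairL μ p p'‖ * ‖w‖ * ‖y‖ ≤ 1 * ‖w‖ * ‖y‖ := by gcongr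
  have := le_abs_self (pairL μ p p' w y)
  rw [Real.norm_eq_abs] at h
  linarith

lemma norm_sub_control (hp : p ≠ ⊤) (hp' : p' ≠ ⊤) {η : ℝ} (hη : 0 < η) :
    ∃ C : ℝ, 0 ≤ C ∧ ∀ v w : Lp ℝ p' μ, ‖v - w‖ ^ p'.toReal ≤
      C * (‖v‖ ^ p'.toReal - ‖w‖ ^ p'.toReal
        - p'.toReal * (pairL μ p p' v (LpJ hp hp' w) - pairL μ p p' w (LpJ hp hp' w)))
      + η * (‖v‖ ^ p'.toReal + ‖w‖ ^ p'.toReal) := by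
  have hr := (toReal_conj (p := p) (p' := p') hp hp').lt
  have h0 : p' ≠ 0 := by rintro rfl; simp at hr; linarith
  obtain ⟨C, hC0, hC⟩ := breg_control hr hη
  refine ⟨C, hC0, fun v w => ?_⟩
  have iv : Integrable (fun x => |v x| ^ p'.toReal) μ := (Lp.memLp v).integrable_norm_rpow h0 hp'
  have iw : Integrable (fun x => |w x| ^ p'.toReal) μ := (Lp.memLp w).integrable_norm_rpow h0 hp'
  have i1 := pairL_integrable v (LpJ (p := p) hp hp' w)
  have i2 := pairL_integrable w (LpJ (p := p) hp hp' w)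
  rw [Lp_norm_rpow h0 hp', Lp_norm_rpow h0 hp', Lp_norm_rpow h0 hp', pairL_eq, pairL_eq]
  have i3 : Integrable (fun x => |v x| ^ p'.toReal - |w x| ^ p'.toReal) μ := iv.sub iw
  have i4 : Integrable (fun x => p'.toReal * (v x * (LpJ (p := p) hp hp' w) x
      - w x * (LpJ (p := p) hp hp' w) x)) μ := (i1.sub i2).const_mul _
  have i5 : Integrable (fun x => C * (|v x| ^ p'.toReal - |w x| ^ p'.toReal
      - p'.toReal * (v x * (LpJ (p := p) hp hp' w) x
      - w x * (LpJ (p := p) hp hp' w) x))) μ := (i3.sub i4).const_mul _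
  have i6 : Integrable (fun x => η * (|v x| ^ p'.toReal + |w x| ^ p'.toReal)) μ :=
    (iv.add iw).const_mul _
  rw [← integral_sub i1 i2, ← integral_const_mul, ← integral_sub iv iw,
    ← integral_sub i3 i4, ← integral_const_mul,
    ← integral_add iv iw, ← integral_const_mul, ← integral_add i5 i6]
  apply integral_mono_ae
  · exact (Lp.memLp (v - w)).integrable_norm_rpow h0 hp'
  · exact i5.add i6
  · filter_upwards [LpJ_coe (p := p) hp hp' w, Lp.coeFn_sub v w] with x hx hy
    have := hC (v x) (w x)
    unfold breg at this
    rw [hy, hx, Pi.sub_apply]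
    refine this.trans (le_of_eq ?_)
    ring

lemma isSeparable_range_of_weak (hp : p ≠ ⊤) (hp' : p' ≠ ⊤) (u : ℝ → Lp ℝ p' μ)
    (hu : ∀ y : Lp ℝ p μ, Continuous fun t => pairL μ p p' (u t) y) :
    TopologicalSpace.IsSeparable (range u) := by
  have hr := (toReal_conj (p := p) (p' := p') hp hp').lt
  set r := p'.toReal with hrdef
  have claim : ∀ δ : ℝ, 0 < δ → ∃ S : Set ℝ, S.Countable ∧ ∀ t, ∃ t' ∈ S,
      ‖u t - u t'‖ ^ r ≤ δ := by
    intro δ hδ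
    have step : ∀ M : ℕ, ∃ ε : ℝ, 0 < ε ∧ ∀ v w : Lp ℝ p' μ, ‖v‖ ^ r ≤ M → ‖w‖ ^ r ≤ M →
        ‖v‖ ^ r - ‖w‖ ^ r ≤ ε →
        |r * (pairL μ p p' v (LpJ hp hp' w) - pairL μ p p' w (LpJ hp hp' w))| < ε →
        ‖v - w‖ ^ r ≤ δ := by
      intro M
      obtain ⟨C, hC0, hC⟩ := norm_sub_control (μ := μ) (p := p) hp hp'
        (η := δ / (2 * (2 * M + 1))) (by positivity)
      refine ⟨δ / (4 * (C + 1)), by positivity, fun v w hv hw h1 h2 => ?_⟩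
      refine (hC v w).trans ?_
      have h3 := neg_abs_le (r * (pairL μ p p' v (LpJ hp hp' w) - pairL μ p p' w (LpJ hp hp' w)))
      have h4 : C * (‖v‖ ^ r - ‖w‖ ^ r
        - r * (pairL μ p p' v (LpJ hp hp' w) - pairL μ p p' w (LpJ hp hp' w)))
          ≤ (C + 1) * (2 * (δ / (4 * (C + 1)))) :=
        (mul_le_mul_of_nonneg_left (by linarith) hC0).trans
          (mul_le_mul_of_nonneg_right (by linarith) (by positivity))
      have h5 : δ / (2 * (2 * M + 1)) * (‖v‖ ^ r + ‖w‖ ^ r)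
          ≤ δ / (2 * (2 * M + 1)) * (2 * M + 1) :=
        mul_le_mul_of_nonneg_left (by linarith) (by positivity)
      have e4 : (C + 1) * (2 * (δ / (4 * (C + 1)))) = δ / 2 := by field_simp; norm_num
      have e5 : δ / (2 * (2 * M + 1)) * (2 * M + 1) = δ / 2 := by field_simp
      linarith
    choose ε hε hstep using step
    let A : ℕ → ℕ → Set ℝ := fun M k => {t | ‖u t‖ ^ r ≤ M ∧ ⌊‖u t‖ ^ r / ε M⌋₊ = k}
    have cover : ∀ M k, ∃ S ⊆ A M k, S.Countable ∧ ∀ t ∈ A M k, ∃ t' ∈ S,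
        ‖u t - u t'‖ ^ r ≤ δ := by
      intro M k
      let U : ℝ → Set ℝ := fun t => {t' | |r * (pairL μ p p' (u t') (LpJ hp hp' (u t))
        - pairL μ p p' (u t) (LpJ hp hp' (u t)))| < ε M}
      have hU : ∀ t ∈ A M k, IsOpen (U t) := fun t _ =>
        isOpen_lt ((continuous_const.mul ((hu _).sub continuous_const)).abs) continuous_const
      obtain ⟨S, hS, hSc, hSU⟩ := TopologicalSpace.isOpen_biUnion_countable (A M k) U hU
      refine ⟨S, hS, hSc, fun t ht => ?_⟩
      have : t ∈ ⋃ i ∈ A M k, U i := mem_biUnion ht (by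
        change |r * (pairL μ p p' (u t) (LpJ hp hp' (u t))
          - pairL μ p p' (u t) (LpJ hp hp' (u t)))| < ε M
        simpa using hε M)
      rw [← hSU, mem_iUnion₂] at this
      obtain ⟨t', ht', htU⟩ := this
      refine ⟨t', ht', hstep M _ _ ht.1 (hS ht').1 ?_ htU⟩
      have e1 := ht.2
      have e2 := (hS ht').2
      have hε' := hε M
      have f1 := Nat.lt_floor_add_one (‖u t‖ ^ r / ε M)
      have f2 := Nat.floor_le (show 0 ≤ ‖u t'‖ ^ r / ε M by positivity)
      rw [e1] at f1
      rw [e2] at f2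
      rw [div_lt_iff₀ hε'] at f1
      rw [le_div_iff₀ hε'] at f2
      linarith
    choose S hSA hSc hS using cover
    refine ⟨⋃ M, ⋃ k, S M k, countable_iUnion fun M => countable_iUnion fun k => hSc M k,
      fun t => ?_⟩
    obtain ⟨M, hM⟩ := exists_nat_ge (‖u t‖ ^ r)
    obtain ⟨t', ht', h⟩ := hS M _ t ⟨hM, rfl⟩
    exact ⟨t', mem_iUnion₂.2 ⟨_, _, ht'⟩, h⟩
  choose! S hSc hS using claim
  refine ⟨⋃ n : ℕ, u '' S ((1 / (n + 1 : ℝ)) ^ r), countable_iUnion fun n =>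
    (hSc _ (by positivity)).image u, ?_⟩
  rintro _ ⟨t, rfl⟩
  rw [Metric.mem_closure_iff]
  intro δ hδ
  obtain ⟨n, hn⟩ := exists_nat_one_div_lt hδ
  obtain ⟨t', ht', h⟩ := hS ((1 / (n + 1 : ℝ)) ^ r) (by positivity) t
  refine ⟨u t', mem_iUnion.2 ⟨n, mem_image_of_mem u ht'⟩, ?_⟩
  rw [dist_eq_norm]
  refine lt_of_le_of_lt ?_ hn
  exact (Real.rpow_le_rpow_iff (norm_nonneg _) (by positivity) (by linarith)).1 h

lemma stronglyMeasurable_of_weak (hp : p ≠ ⊤) (hp' : p' ≠ ⊤) (u : ℝ → Lp ℝ p' μ)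
    (hu : ∀ y : Lp ℝ p μ, Continuous fun t => pairL μ p p' (u t) y) :
    StronglyMeasurable u := by
  let : MeasurableSpace (Lp ℝ p' μ) := borel _
  have : BorelSpace (Lp ℝ p' μ) := ⟨rfl⟩
  have hsep := isSeparable_range_of_weak hp hp' u hu
  refine stronglyMeasurable_iff_measurable_separable.2 ⟨?_, hsep⟩
  have hball : ∀ (w : Lp ℝ p' μ) (δ : ℝ), 0 ≤ δ → MeasurableSet {t | ‖u t - w‖ ≤ δ} := by
    intro w δ hδ
    have : {t | ‖u t - w‖ ≤ δ} = ⋂ y : Lp ℝ p μ,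
        {t | pairL μ p p' (u t) y - pairL μ p p' w y ≤ δ * ‖y‖} := by
      ext t
      simp only [mem_iInter]
      constructor
      · intro h y
        change pairL μ p p' (u t) y - pairL μ p p' w y ≤ δ * ‖y‖
        have h1 := pairL_le (p := p) (u t - w) y
        rw [map_sub, sub_apply] at h1
        exact h1.trans (mul_le_mul_of_nonneg_right h (norm_nonneg _))
      · intro h
        refine norm_le_of_pairL hp hp' _ hδ fun y => ?_
        rw [map_sub, sub_apply]
        exact h y
    rw [this]
    exact (isClosed_iInter fun y =>
      isClosed_le ((hu y).sub continuous_const) continuous_const).measurableSet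
  obtain ⟨c, hc, hcr⟩ := hsep
  refine measurable_of_isOpen fun O hO => ?_
  have : u ⁻¹' O = ⋃ w ∈ c, ⋃ n : ℕ, ⋃ (_ : Metric.closedBall w (1 / (n + 1 : ℝ)) ⊆ O),
      {t | ‖u t - w‖ ≤ 1 / (n + 1 : ℝ)} := by
    ext t
    simp only [mem_iUnion, mem_preimage]
    constructor
    · intro ht
      obtain ⟨δ, hδ, hb⟩ := Metric.isOpen_iff.1 hO _ ht
      obtain ⟨n, hn⟩ := exists_nat_one_div_lt (half_pos hδ)
      obtain ⟨w, hw, hwd⟩ := Metric.mem_closure_iff.1 (hcr (mem_range_self t)) (1 / (n + 1 : ℝ))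
        (by positivity)
      refine ⟨w, hw, n, fun z hz => hb ?_, ?_⟩
      · rw [Metric.mem_closedBall] at hz
        rw [Metric.mem_ball]
        have := dist_triangle z w (u t)
        rw [dist_comm w] at this
        linarith
      · change ‖u t - w‖ ≤ _
        rw [← dist_eq_norm]; exact hwd.le
    · rintro ⟨w, hw, n, hb, ht⟩
      apply hb
      rw [Metric.mem_closedBall, dist_eq_norm]; exact ht
  rw [this]
  exact .biUnion hc fun w _ => .iUnion fun n => .iUnion fun _ => hball w _ (by positivity)

end LpPart

lemma stronglyMeasurable_clm_apply {α E F : Type*} [MeasurableSpace α] [NormedAddCommGroup E]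
    [NormedSpace ℝ E] [NormedAddCommGroup F] [NormedSpace ℝ F] (A : α → E →L[ℝ] F)
    (hA : ∀ y, StronglyMeasurable fun a => A a y) (f : α → E) (hf : StronglyMeasurable f) :
    StronglyMeasurable fun a => A a (f a) := by
  have hs : ∀ φ : SimpleFunc α E, StronglyMeasurable fun a => A a (φ a) := by
    intro φ
    induction φ using SimpleFunc.induction with
    | const c hs =>
      rename_i s
      have : (fun a => A a ((SimpleFunc.piecewise s hs (SimpleFunc.const α c)
          (SimpleFunc.const α 0)) a)) = s.indicator fun a => A a c := by
        ext a
        by_cases h : a ∈ s <;> simp [h]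
      rw [this]
      exact (hA c).indicator hs
    | add _ hf hg =>
      simp only [SimpleFunc.coe_add, Pi.add_apply, map_add]
      exact hf.add hg
  refine stronglyMeasurable_of_tendsto Filter.atTop (fun n => hs (hf.approx n)) ?_
  rw [tendsto_pi_nhds]
  intro a
  exact ((A a).continuous.tendsto _).comp (hf.tendsto_approx a)

lemma stronglyMeasurable_bilin {α E F : Type*} [MeasurableSpace α] [NormedAddCommGroup E]
    [NormedSpace ℝ E] [NormedAddCommGroup F] [NormedSpace ℝ F] (B : E →L[ℝ] F →L[ℝ] ℝ)
    (f : α → E) (g : α → F) (hf : StronglyMeasurable f) (hg : StronglyMeasurable g) :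
    StronglyMeasurable fun a => B (f a) (g a) :=
  B.continuous₂.comp_stronglyMeasurable (hf.prodMk hg)

set_option maxHeartbeats 1000000 in
/-- Fubini–Tonelli exchange for the dual pairing of `L^p` and `L^{p*}` against a strongly
continuous, positivity-preserving operator family (Lemma 2.2 of the paper, deterministic core):
`∫₀ᵀ ⟨f*_t, ∫₀ᵗ Θ(t,s)ρ_s dm(s)⟩ dq(t) = ∫₀ᵀ ⟨∫_sᵀ Θ(t,s)* f*_t dq(t), ρ_s⟩ dm(s)`. -/
theorem stmt_3 (D : Type*) [MeasurableSpace D] (μ : Measure D)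
    (p p' : ℝ≥0∞) (hp : 1 < p) (hp' : p < ⊤) (hconj : p⁻¹ + p'⁻¹ = 1)
    [Fact (1 ≤ p)] [Fact (1 ≤ p')]
    (T : ℝ) (hT : 0 < T)
    (q m : Measure ℝ) [IsFiniteMeasure q] [IsFiniteMeasure m]
    (f : ℝ → Lp ℝ p' μ) (hfmeas : StronglyMeasurable f)
    (hfbdd : ∃ C : ℝ, ∀ t, ‖f t‖ ≤ C)
    (hfpos : ∀ t, 0 ≤ᵐ[μ] ⇑(f t))
    (Θ : ℝ → ℝ → (Lp ℝ p μ →L[ℝ] Lp ℝ p μ))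
    (hΘcont : ∀ y : Lp ℝ p μ,
      ContinuousOn (fun pr : ℝ × ℝ => Θ pr.1 pr.2 y) (Icc 0 T ×ˢ Icc 0 T))
    (hΘpos : ∀ t s (h : Lp ℝ p μ), 0 ≤ᵐ[μ] ⇑h → 0 ≤ᵐ[μ] ⇑(Θ t s h))
    (Θstar : ℝ → ℝ → (Lp ℝ p' μ →L[ℝ] Lp ℝ p' μ))
    (hadj : ∀ t s (g : Lp ℝ p' μ) (h : Lp ℝ p μ),
      ∫ x, (Θstar t s g) x * h x ∂μ = ∫ x, g x * (Θ t s h) x ∂μ)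
    (ρ : ℝ → Lp ℝ p μ) (hρmeas : StronglyMeasurable ρ)
    (hρpos : ∀ s, 0 ≤ᵐ[μ] ⇑(ρ s))
    (hρint : Integrable (fun s => ‖ρ s‖) (m.restrict (Icc 0 T))) :
    ∫ t in Icc 0 T, (∫ x, (f t) x * (∫ s in Icc 0 t, Θ t s (ρ s) ∂m) x ∂μ) ∂q
      = ∫ s in Icc 0 T, (∫ x, (∫ t in Icc s T, Θstar t s (f t) ∂q) x * (ρ s) x ∂μ) ∂m := by
  have hconj' : p'.HolderConjugate p := ⟨by rw [inv_one, add_comm]; exact hconj⟩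
  have hpt : p ≠ ⊤ := hp'.ne
  have hpt' : p' ≠ ⊤ := by
    rintro rfl
    rw [ENNReal.inv_top, add_zero, ENNReal.inv_eq_one] at hconj
    exact hp.ne' hconj
  obtain ⟨C, hC⟩ := hfbdd
  have hC0 : 0 ≤ C := (norm_nonneg _).trans (hC 0)
  -- clamp the time variables
  obtain ⟨c, hcc, hcm, hce⟩ : ∃ c : ℝ → ℝ, Continuous c ∧ (∀ t, c t ∈ Icc 0 T) ∧
      ∀ t ∈ Icc 0 T, c t = t := by
    refine ⟨fun t => max 0 (min t T), by fun_prop,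
      fun t => ⟨le_max_left _ _, max_le hT.le (min_le_right _ _)⟩, fun t ht => ?_⟩
    simp only
    rw [min_eq_left ht.2, max_eq_right ht.1]
  obtain ⟨Φ, hΦe⟩ : ∃ Φ : ℝ × ℝ → (Lp ℝ p μ →L[ℝ] Lp ℝ p μ),
      ∀ z, Φ z = Θ (c z.1) (c z.2) := ⟨_, fun z => rfl⟩
  have hΦ : ∀ y, Continuous fun z => Φ z y := fun y => by
    simp only [hΦe]
    exact (hΘcont y).comp_continuous (f := fun z : ℝ × ℝ => (c z.1, c z.2)) (by fun_prop)
      (fun z => ⟨hcm _, hcm _⟩)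
  obtain ⟨M, hM⟩ : ∃ M, ∀ z, ‖Φ z‖ ≤ M := by
    apply banach_steinhaus
    intro y
    obtain ⟨B, hB⟩ := (isCompact_Icc.prod isCompact_Icc).exists_bound_of_continuousOn (hΘcont y)
    refine ⟨B, fun z => ?_⟩
    rw [hΦe]
    exact hB (c z.1, c z.2) ⟨hcm _, hcm _⟩
  have hM0 : 0 ≤ M := (norm_nonneg _).trans (hM 0)
  have smΦ : StronglyMeasurable fun z : ℝ × ℝ => Φ z (ρ z.2) :=
    stronglyMeasurable_clm_apply Φ (fun y => (hΦ y).stronglyMeasurable) _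
      (hρmeas.comp_measurable measurable_snd)
  obtain ⟨G, hG⟩ : ∃ G : ℝ → ℝ → ℝ, ∀ t s, G t s = pairL μ p p' (f t) (Φ (t, s) (ρ s)) :=
    ⟨_, fun _ _ => rfl⟩
  have smG : StronglyMeasurable fun z : ℝ × ℝ => G z.1 z.2 := by
    simp only [hG]
    exact stronglyMeasurable_bilin (pairL μ p p') _ _ (hfmeas.comp_measurable measurable_fst) smΦ
  have hadj' : ∀ t s (g : Lp ℝ p' μ) (h : Lp ℝ p μ),
      pairL μ p p' (Θstar t s g) h = pairL μ p p' g (Θ t s h) := fun t s g h => by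
    rw [pairL_eq, pairL_eq, hadj]
  -- left-hand side
  have hL : ∀ t ∈ Icc 0 T, (∫ x, (f t) x * (∫ s in Icc 0 t, Θ t s (ρ s) ∂m) x ∂μ)
      = ∫ s in Icc 0 T, (if s ≤ t then G t s else 0) ∂m := by
    intro t ht
    have hi : Integrable (fun s => Φ (t, s) (ρ s)) (m.restrict (Icc 0 T)) := by
      refine (hρint.const_mul M).mono'
        (smΦ.comp_measurable measurable_prodMk_left).aestronglyMeasurable
        (Filter.Eventually.of_forall fun s => ?_)
      exact (Φ (t, s)).le_of_opNorm_le (hM _) _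
    have hsub : Icc 0 t ⊆ Icc 0 T := Icc_subset_Icc_right ht.2
    have e1 : ∫ s in Icc 0 t, Θ t s (ρ s) ∂m = ∫ s in Icc 0 t, Φ (t, s) (ρ s) ∂m := by
      refine setIntegral_congr_fun measurableSet_Icc fun s hs => ?_
      simp only [hΦe]
      rw [hce t ht, hce s (hsub hs)]
    rw [e1, ← pairL_eq, ← ContinuousLinearMap.integral_comp_comm _
      (hi.mono_measure (Measure.restrict_mono hsub le_rfl))]
    have e2 : ∀ s ∈ Icc 0 T, (if s ≤ t then G t s else 0) = (Icc 0 t).indicator (G t) s := by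
      intro s hs
      by_cases h : s ≤ t
      · rw [if_pos h, indicator_of_mem (show s ∈ Icc 0 t from ⟨hs.1, h⟩)]
      · rw [if_neg h, indicator_of_notMem (fun h' => h h'.2)]
    rw [setIntegral_congr_fun measurableSet_Icc e2, setIntegral_indicator measurableSet_Icc,
      inter_eq_self_of_subset_right hsub]
    simp only [hG]
  -- right-hand side
  have hR : ∀ s ∈ Icc 0 T, (∫ x, (∫ t in Icc s T, Θstar t s (f t) ∂q) x * (ρ s) x ∂μ)
      = ∫ t in Icc 0 T, (if s ≤ t then G t s else 0) ∂q := by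
    intro s hs
    have sm1 : ∀ g : Lp ℝ p' μ, StronglyMeasurable fun t => Θstar (c t) s g := by
      intro g
      refine stronglyMeasurable_of_weak (p := p) hpt hpt' _ fun y => ?_
      simp only [hadj']
      have := (pairL μ p p' g).continuous.comp
        ((hΦ y).comp (f := fun t : ℝ => (t, s)) (by fun_prop))
      refine this.congr fun t => ?_
      simp only [Function.comp, hΦe, hce s hs]
    have sm2 : StronglyMeasurable fun t => Θstar (c t) s (f t) :=
      stronglyMeasurable_clm_apply (fun t => Θstar (c t) s) sm1 f hfmeas
    have hi : Integrable (fun t => Θstar (c t) s (f t)) q := by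
      refine (integrable_const (C * M)).mono' sm2.aestronglyMeasurable
        (Filter.Eventually.of_forall fun t => ?_)
      refine norm_le_of_pairL (p := p) hpt hpt' _ (by positivity) fun y => ?_
      rw [hadj']
      refine (pairL_le _ _).trans ?_
      rw [mul_assoc]
      refine mul_le_mul (hC t) ?_ (norm_nonneg _) hC0
      have := (Φ (t, s)).le_of_opNorm_le (hM _) y
      simpa only [hΦe, hce s hs] using this
    have hsub : Icc s T ⊆ Icc 0 T := Icc_subset_Icc_left hs.1
    have e1 : ∫ t in Icc s T, Θstar t s (f t) ∂q = ∫ t in Icc s T, Θstar (c t) s (f t) ∂q := by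
      refine setIntegral_congr_fun measurableSet_Icc fun t ht => ?_
      rw [hce t (hsub ht)]
    rw [e1, ← pairL_eq, ← ContinuousLinearMap.flip_apply,
      ← ContinuousLinearMap.integral_comp_comm _ hi.integrableOn]
    have e2 : ∀ t ∈ Icc 0 T, (if s ≤ t then G t s else 0)
        = (Icc s T).indicator (fun t => G t s) t := by
      intro t ht
      by_cases h : s ≤ t
      · rw [if_pos h, indicator_of_mem (show t ∈ Icc s T from ⟨h, ht.2⟩)]
      · rw [if_neg h, indicator_of_notMem (fun h' => h h'.1)]
    rw [setIntegral_congr_fun measurableSet_Icc e2, setIntegral_indicator measurableSet_Icc,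
      inter_eq_self_of_subset_right hsub]
    refine integral_congr_ae (Filter.Eventually.of_forall fun t => ?_)
    simp only [ContinuousLinearMap.flip_apply, hadj', hG, hΦe, hce s hs]
  rw [setIntegral_congr_fun measurableSet_Icc hL, setIntegral_congr_fun measurableSet_Icc hR]
  apply integral_integral_swap (f := fun t s => if s ≤ t then G t s else 0)
  have hdom : Integrable (fun z : ℝ × ℝ => C * M * ‖ρ z.2‖)
      ((q.restrict (Icc 0 T)).prod (m.restrict (Icc 0 T))) :=
    (hρint.comp_snd _).const_mul _
  refine hdom.mono' ?_ (Filter.Eventually.of_forall fun z => ?_)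
  · exact (StronglyMeasurable.ite (measurableSet_le measurable_snd measurable_fst) smG
      stronglyMeasurable_const).aestronglyMeasurable
  · have hnn : 0 ≤ C * M * ‖ρ z.2‖ := by positivity
    have key : |G z.1 z.2| ≤ C * M * ‖ρ z.2‖ := by
      have b1 : ∀ y : Lp ℝ p μ, ‖Φ (z.1, z.2) y‖ ≤ M * ‖y‖ := fun y =>
        (Φ (z.1, z.2)).le_of_opNorm_le (hM _) y
      have b2 : ‖f z.1‖ * ‖Φ (z.1, z.2) (ρ z.2)‖ ≤ C * M * ‖ρ z.2‖ := by
        rw [mul_assoc]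
        exact mul_le_mul (hC _) (b1 _) (norm_nonneg _) hC0
      refine abs_le.2 ⟨?_, (hG _ _).le.trans ((pairL_le _ _).trans b2)⟩
      have := pairL_le (p := p) (-(f z.1)) (Φ (z.1, z.2) (ρ z.2))
      rw [map_neg, neg_apply, norm_neg] at this
      rw [hG]
      linarith
    simp only [Function.uncurry_def]
    split_ifs
    · exact key
    · simpa using hnn
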